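/- For every real x < 0, one has α·(u(x))² < 2 and α·(u'(x))² < −x (equivalently, 1/(u(x))² > α/2 and −x/(u'(x))² > α wherever the denominators are nonzero). -/

import Mathlib

open Real Set

/-- `α = Γ(1/3)/(3^(1/3)·Γ(2/3))`, the common limit at `+∞` of `v/u` and `v'/u'`
(equal to `-Ai(0)/Ai'(0)`). -/
noncomputable def airyAlpha : ℝ :=
  Real.Gamma (1/3) / ((3:ℝ) ^ ((1:ℝ)/3) * Real.Gamma (2/3))

open Filter Topology

theorem airyAlpha_pos : 0 < airyAlpha := by
  unfold airyAlpha
  have h1 : 0 < Real.Gamma (1 / 3) := Real.Gamma_pos_of_pos (by norm_num)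
  have h2 : 0 < Real.Gamma (2 / 3) := Real.Gamma_pos_of_pos (by norm_num)
  positivity

/-- Log-convexity of `Γ` between `10/3`, `13/3` and `14/3`. -/
theorem Gamma_thirteen_thirds_pow_le :
    Real.Gamma (13 / 3) ^ 4 ≤ Real.Gamma (14 / 3) ^ 3 * Real.Gamma (10 / 3) := by
  have h10 : 0 < Real.Gamma (10 / 3) := Real.Gamma_pos_of_pos (by norm_num)
  have h13 : 0 < Real.Gamma (13 / 3) := Real.Gamma_pos_of_pos (by norm_num)
  have h14 : 0 < Real.Gamma (14 / 3) := Real.Gamma_pos_of_pos (by norm_num)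
  have h := Real.convexOn_log_Gamma.2 (mem_Ioi.2 (show (0 : ℝ) < 14 / 3 by norm_num))
    (mem_Ioi.2 (show (0 : ℝ) < 10 / 3 by norm_num)) (show (0 : ℝ) ≤ 3 / 4 by norm_num)
    (show (0 : ℝ) ≤ 1 / 4 by norm_num) (by norm_num)
  simp only [smul_eq_mul, Function.comp_apply] at h
  rw [show (3 / 4 * (14 / 3) + 1 / 4 * (10 / 3) : ℝ) = 13 / 3 by norm_num] at h
  rw [← Real.log_le_log_iff (by positivity) (by positivity),
    Real.log_mul (by positivity) (by positivity), Real.log_pow, Real.log_pow]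
  push_cast
  linarith

theorem airyAlpha_lt : airyAlpha < 1.46 := by
  have ha : 0 < Real.Gamma (1 / 3) := Real.Gamma_pos_of_pos (by norm_num)
  have hb : 0 < Real.Gamma (2 / 3) := Real.Gamma_pos_of_pos (by norm_num)
  have shift : ∀ s t : ℝ, 0 < s → t = s + 1 → Real.Gamma t = s * Real.Gamma s := by
    rintro s t hs rfl
    exact Real.Gamma_add_one hs.ne'
  have hc := Gamma_thirteen_thirds_pow_le
  rw [shift (10 / 3) (13 / 3) (by norm_num) (by norm_num),
    shift (7 / 3) (10 / 3) (by norm_num) (by norm_num),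
    shift (4 / 3) (7 / 3) (by norm_num) (by norm_num),
    shift (1 / 3) (4 / 3) (by norm_num) (by norm_num),
    shift (11 / 3) (14 / 3) (by norm_num) (by norm_num),
    shift (8 / 3) (11 / 3) (by norm_num) (by norm_num),
    shift (5 / 3) (8 / 3) (by norm_num) (by norm_num),
    shift (2 / 3) (5 / 3) (by norm_num) (by norm_num)] at hc
  unfold airyAlpha
  set a := Real.Gamma (1 / 3)
  set b := Real.Gamma (2 / 3)
  have hr : ((3 : ℝ) ^ ((1 : ℝ) / 3)) ^ 3 = 3 := by
    rw [← Real.rpow_natCast, ← Real.rpow_mul (by norm_num)]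
    norm_num
  set r := (3 : ℝ) ^ ((1 : ℝ) / 3)
  have hr0 : 0 < r := by positivity
  have hcube : (280 * a) ^ 3 * 10 ≤ (880 * b) ^ 3 * 3 := by
    refine le_of_mul_le_mul_right ?_ ha
    nlinarith [hc]
  rw [div_lt_iff₀ (by positivity)]
  refine lt_of_pow_lt_pow_left₀ 3 (by positivity) ?_
  have : (1.46 * (r * b)) ^ 3 = 1.46 ^ 3 * 3 * b ^ 3 := by
    rw [← hr]; ring
  rw [this]
  have hb3 : 0 < b ^ 3 := by positivity
  nlinarith

theorem nonneg_of_hasDerivAt_nonneg {f f' : ℝ → ℝ} (hf : ∀ y, HasDerivAt f (f' y) y)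
    (h0 : 0 ≤ f 0) (hf' : ∀ y, 0 ≤ y → 0 ≤ f' y) {y : ℝ} (hy : 0 ≤ y) : 0 ≤ f y := by
  have hmono : MonotoneOn f (Ici 0) := by
    refine monotoneOn_of_hasDerivWithinAt_nonneg (f' := f') (convex_Ici 0)
      (fun x _ => (hf x).continuousAt.continuousWithinAt)
      (fun x _ => (hf x).hasDerivWithinAt) (fun x hx => hf' x ?_)
    rw [interior_Ici] at hx
    exact le_of_lt hx
  exact h0.trans (hmono self_mem_Ici hy hy)

section ReflectedAiry

variable {w p : ℝ → ℝ} (hw : ∀ y, HasDerivAt w (-p y) y) (hp : ∀ y, HasDerivAt p (y * w y) y)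

include hw hp

theorem airyEnergy_antitoneOn : AntitoneOn (fun y => w y ^ 2 + p y ^ 2 / y) (Ioi 0) := by
  have hd : ∀ y ∈ Ioi (0 : ℝ), HasDerivAt (fun y => w y ^ 2 + p y ^ 2 / y) (-(p y / y) ^ 2) y := by
    intro y hy
    have hy' : y ≠ 0 := ne_of_gt hy
    refine (((hw y).pow 2).add (((hp y).pow 2).div (hasDerivAt_id y) hy')).congr_deriv ?_
    simp only [id, Pi.pow_apply]
    push_cast
    field_simp
    ring
  refine antitoneOn_of_hasDerivWithinAt_nonpos (convex_Ioi 0)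
    (fun y hy => (hd y hy).continuousAt.continuousWithinAt)
    (fun y hy => (hd y (interior_subset hy)).hasDerivWithinAt)
    (fun y _ => by nlinarith [sq_nonneg (p y / y)])

variable (hw0 : w 0 = 1) (hp0 : p 0 = 0)

include hw0 hp0

theorem airyEnergy_le_one {y : ℝ} (hy : 0 < y) : w y ^ 2 + p y ^ 2 / y ≤ 1 := by
  have hslope : Tendsto (fun y => y⁻¹ * p y) (𝓝[>] 0) (𝓝 0) := by
    have h := (hp 0).tendsto_slope_zero_right
    simpa [hp0] using h
  have hwc : Tendsto w (𝓝[>] 0) (𝓝 1) := by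
    simpa [hw0] using (hw 0).continuousAt.tendsto.mono_left nhdsWithin_le_nhds
  have hpc : Tendsto p (𝓝[>] 0) (𝓝 0) := by
    simpa [hp0] using (hp 0).continuousAt.tendsto.mono_left nhdsWithin_le_nhds
  have hlim : Tendsto (fun y => w y ^ 2 + p y ^ 2 / y) (𝓝[>] 0) (𝓝 1) := by
    have h := (hwc.pow 2).add (hpc.mul hslope)
    simp only [one_pow, mul_zero, add_zero] at h
    refine h.congr fun z => ?_
    ring
  refine ge_of_tendsto hlim ?_
  filter_upwards [Ioc_mem_nhdsGT hy] with z hz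
  exact airyEnergy_antitoneOn hw hp hz.1 hy hz.2

/-- Alternating Taylor bounds at `0` for the reflected Airy solution `w` and its negated derivative `p`. -/
theorem airy_taylor_bounds {y : ℝ} (hy : 0 ≤ y) :
    (y ^ 2 / 2 - y ^ 5 / 30 ≤ p y ∧ p y ≤ y ^ 2 / 2 - y ^ 5 / 30 + y ^ 8 / 1440) ∧
    (1 - y ^ 3 / 6 + y ^ 6 / 180 - y ^ 9 / 12960 ≤ w y ∧
      w y ≤ 1 - y ^ 3 / 6 + y ^ 6 / 180) := by
  have pw : ∀ (n : ℕ) (c y : ℝ), HasDerivAt (fun y : ℝ => y ^ n / c) (n * y ^ (n - 1) / c) y :=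
    fun n c y => (hasDerivAt_pow n y).div_const c
  have w1 : ∀ y, 0 ≤ y → w y ≤ 1 := by
    intro y hy
    rcases hy.eq_or_lt with rfl | hy
    · exact hw0.le
    · have h := airyEnergy_le_one hw hp hw0 hp0 hy
      have : 0 ≤ p y ^ 2 / y := by positivity
      nlinarith
  have p1 : ∀ y, 0 ≤ y → p y ≤ y ^ 2 / 2 := by
    intro y hy
    refine sub_nonneg.1 (nonneg_of_hasDerivAt_nonneg (f := fun y => y ^ 2 / 2 - p y)
      (fun y => (pw 2 2 y).sub (hp y)) (by simp [hp0]) (fun y hy => ?_) hy)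
    norm_num
    nlinarith [mul_le_mul_of_nonneg_left (w1 y hy) hy]
  have w2 : ∀ y, 0 ≤ y → 1 - y ^ 3 / 6 ≤ w y := by
    intro y hy
    refine sub_nonneg.1 (nonneg_of_hasDerivAt_nonneg (f := fun y => w y - (1 - y ^ 3 / 6))
      (fun y => (hw y).sub ((pw 3 6 y).const_sub 1)) (by simp [hw0]) (fun y hy => ?_) hy)
    norm_num
    linarith [p1 y hy]
  have p2 : ∀ y, 0 ≤ y → y ^ 2 / 2 - y ^ 5 / 30 ≤ p y := by
    intro y hy
    refine sub_nonneg.1 (nonneg_of_hasDerivAt_nonneg (f := fun y => p y - (y ^ 2 / 2 - y ^ 5 / 30))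
      (fun y => (hp y).sub ((pw 2 2 y).sub (pw 5 30 y))) (by simp [hp0]) (fun y hy => ?_) hy)
    norm_num
    nlinarith [mul_le_mul_of_nonneg_left (w2 y hy) hy]
  have w3 : ∀ y, 0 ≤ y → w y ≤ 1 - y ^ 3 / 6 + y ^ 6 / 180 := by
    intro y hy
    refine sub_nonneg.1 (nonneg_of_hasDerivAt_nonneg
      (f := fun y => 1 - y ^ 3 / 6 + y ^ 6 / 180 - w y)
      (fun y => (((pw 3 6 y).const_sub 1).add (pw 6 180 y)).sub (hw y))
      (by simp [hw0]) (fun y hy => ?_) hy)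
    norm_num
    linarith [p2 y hy]
  have p3 : ∀ y, 0 ≤ y → p y ≤ y ^ 2 / 2 - y ^ 5 / 30 + y ^ 8 / 1440 := by
    intro y hy
    refine sub_nonneg.1 (nonneg_of_hasDerivAt_nonneg
      (f := fun y => y ^ 2 / 2 - y ^ 5 / 30 + y ^ 8 / 1440 - p y)
      (fun y => (((pw 2 2 y).sub (pw 5 30 y)).add (pw 8 1440 y)).sub (hp y))
      (by simp [hp0]) (fun y hy => ?_) hy)
    norm_num
    nlinarith [mul_le_mul_of_nonneg_left (w3 y hy) hy]
  have w4 : ∀ y, 0 ≤ y → 1 - y ^ 3 / 6 + y ^ 6 / 180 - y ^ 9 / 12960 ≤ w y := by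
    intro y hy
    refine sub_nonneg.1 (nonneg_of_hasDerivAt_nonneg
      (f := fun y => w y - (1 - y ^ 3 / 6 + y ^ 6 / 180 - y ^ 9 / 12960))
      (fun y => (hw y).sub ((((pw 3 6 y).const_sub 1).add (pw 6 180 y)).sub (pw 9 12960 y)))
      (by simp [hw0]) (fun y hy => ?_) hy)
    norm_num
    linarith [p3 y hy]
  exact ⟨⟨p2 y hy, p3 y hy⟩, w4 y hy, w3 y hy⟩

theorem airy_deriv_sq_le {y : ℝ} (hy : 0 < y) : p y ^ 2 ≤ 0.68 * y := by
  rcases le_total y 1.9 with hle | hge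
  · obtain ⟨⟨hl, hu⟩, -⟩ := airy_taylor_bounds hw hp hw0 hp0 hy.le
    have ht : y ^ 3 ≤ 1.9 ^ 3 := pow_le_pow_left₀ hy.le hle 3
    have ht0 : 0 < y ^ 3 := by positivity
    have hp_nonneg : 0 ≤ p y := by
      refine le_trans ?_ hl
      have : y ^ 2 / 2 - y ^ 5 / 30 = y ^ 2 * (1 / 2 - y ^ 3 / 30) := by ring
      rw [this]
      refine mul_nonneg (by positivity) ?_
      norm_num at ht
      linarith
    have hp_le : p y ≤ y ^ 2 * (0.5 - 0.0285 * y ^ 3) := by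
      refine hu.trans ?_
      have : y ^ 2 / 2 - y ^ 5 / 30 + y ^ 8 / 1440
          = y ^ 2 * (1 / 2 - y ^ 3 / 30 + (y ^ 3) ^ 2 / 1440) := by ring
      rw [this]
      refine mul_le_mul_of_nonneg_left ?_ (by positivity)
      nlinarith
    have hcubic : y ^ 3 * (0.5 - 0.0285 * y ^ 3) ^ 2 ≤ 0.68 := by
      generalize y ^ 3 = t at ht ht0
      norm_num at ht ⊢
      nlinarith [mul_nonneg ht0.le (sq_nonneg (t - 5.85)), sq_nonneg (t - 5.85)]
    calc p y ^ 2 ≤ (y ^ 2 * (0.5 - 0.0285 * y ^ 3)) ^ 2 := pow_le_pow_left₀ hp_nonneg hp_le 2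
      _ = y ^ 3 * (0.5 - 0.0285 * y ^ 3) ^ 2 * y := by ring
      _ ≤ 0.68 * y := mul_le_mul_of_nonneg_right hcubic hy.le
  · obtain ⟨⟨hl, hu⟩, hwl, hwu⟩ := airy_taylor_bounds hw hp hw0 hp0 (y := 1.9) (by norm_num)
    have hE := airyEnergy_antitoneOn hw hp (show (1.9 : ℝ) ∈ Ioi 0 by norm_num [mem_Ioi]) hy hge
    simp only at hE
    have h1 : w 1.9 ^ 2 ≤ 0.12 ^ 2 := by
      refine pow_le_pow_left₀ (le_trans ?_ hwl) (hwu.trans ?_) 2 <;> norm_num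
    have h2 : p 1.9 ^ 2 ≤ 1.1 ^ 2 := by
      refine pow_le_pow_left₀ (le_trans ?_ hl) (hu.trans ?_) 2 <;> norm_num
    have h3 : p 1.9 ^ 2 / 1.9 ≤ 1.1 ^ 2 / 1.9 := div_le_div_of_nonneg_right h2 (by norm_num)
    have h4 : p y ^ 2 / y ≤ 0.68 := by
      norm_num at h1 h3 hE ⊢
      linarith [sq_nonneg (w y)]
    exact (div_le_iff₀ hy).1 h4

end ReflectedAiry

theorem stmt_4 (u v u' v' : ℝ → ℝ)
    (hu : ∀ x, HasDerivAt u (u' x) x)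
    (huAiry : ∀ x, HasDerivAt u' (x * u x) x)
    (hv : ∀ x, HasDerivAt v (v' x) x)
    (hvAiry : ∀ x, HasDerivAt v' (x * v x) x)
    (hu0 : u 0 = 1) (hu'0 : u' 0 = 0) (hv0 : v 0 = 0) (hv'0 : v' 0 = 1) :
    ∀ x : ℝ, x < 0 →
      airyAlpha * (u x) ^ 2 < 2 ∧ airyAlpha * (u' x) ^ 2 < -x := by
  intro x hx
  have hw : ∀ y, HasDerivAt (fun y => u (-y)) (-(fun y => u' (-y)) y) y := fun y => by
    simpa [Function.comp_def] using (hu (-y)).comp y (hasDerivAt_neg y)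
  have hp : ∀ y, HasDerivAt (fun y => u' (-y)) (y * (fun y => u (-y)) y) y := fun y => by
    simpa [Function.comp_def] using (huAiry (-y)).comp y (hasDerivAt_neg y)
  have hx' : 0 < -x := by linarith
  have h1 := airyEnergy_le_one hw hp (by simpa using hu0) (by simpa using hu'0) hx'
  have h2 := airy_deriv_sq_le hw hp (by simpa using hu0) (by simpa using hu'0) hx'
  simp only [neg_neg] at h1 h2
  have hα := airyAlpha_lt
  have hα0 := airyAlpha_pos
  have h3 : 0 ≤ u' x ^ 2 / -x := by positivity
  constructor
  · have := mul_le_mul_of_nonneg_left (show u x ^ 2 ≤ 1 by linarith) hα0.le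
    norm_num at hα
    linarith
  · have := mul_le_mul_of_nonneg_left h2 hα0.le
    norm_num at hα this
    nlinarith
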